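/- Let M be a random variable on a probability space (Ω, P) with values in a standard Borel space F, and let (X^{(t)})_{t ∈ ℕ} be random variables with values in a standard Borel space E such that for every t ≥ 1, KL(law(X^{(t)}, M) ‖ law(X^{(t-1)}) ⊗ law(M)) ≤ I(X^{(t-1)}; M). Then the sequence t ↦ I(X^{(t)}; M) is non-increasing. (Proposition 1: the mutual information between the MIRI-imputed data and the missingness mask is non-increasing after each iteration.) -/

import Mathlib

open MeasureTheory ProbabilityTheory
open scoped ENNReal Classical

/-- The Kullback–Leibler divergence `KL(μ ‖ ν)`: equal to `∫ log (dμ/dν) dμ` if `μ ≪ ν` and the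
integral is defined, and `+∞` otherwise. -/
noncomputable def klDiv {α : Type*} [MeasurableSpace α] (μ ν : Measure α) : ℝ≥0∞ :=
  if μ ≪ ν ∧ Integrable (llr μ ν) μ then ENNReal.ofReal (∫ x, llr μ ν x ∂μ) else ⊤

/-- The mutual information `I(X; M)` between two random variables, defined as the KL divergence
between the joint law and the product of the marginal laws. -/
noncomputable def mutualInfo {Ω E F : Type*} [MeasurableSpace Ω] [MeasurableSpace E]
    [MeasurableSpace F] (P : Measure Ω) (X : Ω → E) (M : Ω → F) : ℝ≥0∞ :=
  klDiv (P.map (fun ω => (X ω, M ω))) ((P.map X).prod (P.map M))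

/-- For probability measures, `klDiv` agrees with Mathlib's `InformationTheory.klDiv`. -/
theorem klDiv_eq_informationTheory_klDiv {α : Type*} [MeasurableSpace α] (μ ν : Measure α)
    [IsProbabilityMeasure μ] [IsProbabilityMeasure ν] :
    klDiv μ ν = InformationTheory.klDiv μ ν := by
  simp [klDiv, InformationTheory.klDiv_def]

/-- The mutual information between `X` and `M` is at most the Kullback–Leibler divergence of the
joint law from any product of a probability measure with the law of `M`. -/
theorem mutualInfo_le_klDiv_prod {Ω E F : Type*} [MeasurableSpace Ω] [MeasurableSpace E]
    [MeasurableSpace F] [StandardBorelSpace F] (P : Measure Ω) [IsProbabilityMeasure P]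
    {X : Ω → E} {M : Ω → F} (hX : Measurable X) (hM : Measurable M)
    (ν : Measure E) [IsProbabilityMeasure ν] :
    mutualInfo P X M ≤ klDiv (P.map (fun ω => (X ω, M ω))) (ν.prod (P.map M)) := by
  have : Nonempty F := (nonempty_of_isProbabilityMeasure P).map M
  have := Measure.isProbabilityMeasure_map (μ := P) hX.aemeasurable
  have := Measure.isProbabilityMeasure_map (μ := P) hM.aemeasurable
  have := Measure.isProbabilityMeasure_map (μ := P) (hX.prodMk hM).aemeasurable
  rw [mutualInfo, klDiv_eq_informationTheory_klDiv, klDiv_eq_informationTheory_klDiv,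
    ← compProd_map_condDistrib hM.aemeasurable, ← Measure.compProd_const, ← Measure.compProd_const,
    InformationTheory.klDiv_compProd_eq_add (ν := ν)]
  exact le_add_self

/-- Proposition 1 (MIRI): if at every iteration `t ≥ 1` the imputer achieves a KL value
`KL(law(X^{(t)}, M) ‖ law(X^{(t-1)}) ⊗ law(M))` at most the mutual information
`I(X^{(t-1)}; M)` (the value achieved by the identity imputer), then the sequence
`t ↦ I(X^{(t)}; M)` is non-increasing. -/
theorem mutualInfo_antitone_of_klDiv_le
    {Ω E F : Type*} [MeasurableSpace Ω]
    [MeasurableSpace E] [StandardBorelSpace E] [MeasurableSpace F] [StandardBorelSpace F]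
    (P : Measure Ω) [IsProbabilityMeasure P]
    (X : ℕ → Ω → E) (M : Ω → F)
    (hX : ∀ t, Measurable (X t)) (hM : Measurable M)
    (h : ∀ t : ℕ, 1 ≤ t →
      klDiv (P.map (fun ω => (X t ω, M ω))) ((P.map (X (t - 1))).prod (P.map M))
        ≤ mutualInfo P (X (t - 1)) M) :
    Antitone (fun t => mutualInfo P (X t) M) := by
  refine antitone_nat_of_succ_le fun t => ?_
  have := Measure.isProbabilityMeasure_map (μ := P) (hX t).aemeasurable
  exact (mutualInfo_le_klDiv_prod P (hX (t + 1)) hM (P.map (X t))).trans (h (t + 1) t.succ_pos)
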